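/- Madelung–Bohm form of the Schrödinger equation: let W ⊆ ℝ × ℝ³ be a nonempty open set, a, S : W → ℝ smooth with a > 0, V : W → ℝ smooth, ħ, m > 0, and set ρ = a² and ψ = a e^{iS/ħ}. Then ψ satisfies the Schrödinger equation iħ ∂_t ψ = −(ħ²/(2m)) Δψ + V ψ on W if and only if the pair (ρ, S) satisfies both the continuity equation ∂_t ρ + div( ρ ∇S/m ) = 0 and the Hamilton–Jacobi equation ∂_t S + |∇S|²/(2m) + V − (ħ²/(4m)) ( Δρ/ρ − (1/2)|∇ρ|²/ρ² ) = 0 on W. -/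

import Mathlib

noncomputable section

open scoped BigOperators

/-- Partial derivative `∂_μ f` of a real-valued function on `ℝⁿ`. -/
def pd {n : ℕ} (μ : Fin n) (f : (Fin n → ℝ) → ℝ) : (Fin n → ℝ) → ℝ :=
  fun x => fderiv ℝ f x (Pi.single μ 1)

/-- Partial derivative `∂_μ f` of a complex-valued function on `ℝⁿ`. -/
def pdC {n : ℕ} (μ : Fin n) (f : (Fin n → ℝ) → ℂ) : (Fin n → ℝ) → ℂ :=
  fun x => fderiv ℝ f x (Pi.single μ 1)

/-- Christoffel symbols `_gΓ^μ_{νλ}` of the metric `g` (with inverse `ginv`). -/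
def christoffel {n : ℕ} (g ginv : (Fin n → ℝ) → Fin n → Fin n → ℝ)
    (μ ν lam : Fin n) (x : Fin n → ℝ) : ℝ :=
  (1/2) * ∑ κ, ginv x μ κ *
    (pd ν (fun y => g y κ lam) x + pd lam (fun y => g y κ ν) x - pd κ (fun y => g y ν lam) x)

/-- Weylian affine connection `Γ^μ_{νλ}` of the Weylian metric `(g, φ)`:
`Γ^μ_{νλ} = _gΓ^μ_{νλ} + δ^μ_ν φ_λ + δ^μ_λ φ_ν − g_{νλ} φ^μ`. -/
def weylConn {n : ℕ} (g ginv : (Fin n → ℝ) → Fin n → Fin n → ℝ)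
    (φ : (Fin n → ℝ) → Fin n → ℝ) (μ ν lam : Fin n) (x : Fin n → ℝ) : ℝ :=
  christoffel g ginv μ ν lam x
    + (if ν = μ then φ x lam else 0) + (if lam = μ then φ x ν else 0)
    - g x ν lam * ∑ κ, ginv x μ κ * φ x κ

/-- Curvature tensor `R^μ_{νλκ}` of a family of connection coefficients `Γ`. -/
def curvOf {n : ℕ} (Γ : (Fin n → ℝ) → Fin n → Fin n → Fin n → ℝ)
    (μ ν lam κ : Fin n) (x : Fin n → ℝ) : ℝ :=
  pd lam (fun y => Γ y μ ν κ) x - pd κ (fun y => Γ y μ ν lam) x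
    + ∑ σ, Γ x μ lam σ * Γ x σ ν κ - ∑ σ, Γ x μ κ σ * Γ x σ ν lam

/-- Ricci tensor `R_{νκ} = R^μ_{νμκ}`. -/
def ricciOf {n : ℕ} (Γ : (Fin n → ℝ) → Fin n → Fin n → Fin n → ℝ)
    (ν κ : Fin n) (x : Fin n → ℝ) : ℝ :=
  ∑ μ, curvOf Γ μ ν μ κ x

/-- Scalar curvature `R = g^{νκ} R_{νκ}`. -/
def scalarOf {n : ℕ} (ginv : (Fin n → ℝ) → Fin n → Fin n → ℝ)
    (Γ : (Fin n → ℝ) → Fin n → Fin n → Fin n → ℝ) (x : Fin n → ℝ) : ℝ :=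
  ∑ ν, ∑ κ, ginv x ν κ * ricciOf Γ ν κ x

/-- Volume factor `√|det g|`. -/
def volFac {n : ℕ} (g : (Fin n → ℝ) → Fin n → Fin n → ℝ) (x : Fin n → ℝ) : ℝ :=
  Real.sqrt |Matrix.det (Matrix.of (g x))|

/-- Laplace–Beltrami operator `Δ_g f = (1/√|det g|) ∂_μ ( √|det g| g^{μν} ∂_ν f )`. -/
def laplaceBeltrami {n : ℕ} (g ginv : (Fin n → ℝ) → Fin n → Fin n → ℝ)
    (f : (Fin n → ℝ) → ℝ) (x : Fin n → ℝ) : ℝ :=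
  (volFac g x)⁻¹ * ∑ μ, pd μ (fun y => volFac g y * ∑ ν, ginv y μ ν * pd ν f y) x

/-- Minkowski matrix `η = diag(1, −1, −1, −1)`. -/
def etaM : Fin 4 → Fin 4 → ℝ :=
  fun μ ν => if μ = ν then (if μ = 0 then 1 else -1) else 0

section PartialDerivatives

variable {n : ℕ} {f g : (Fin n → ℝ) → ℝ} {x : Fin n → ℝ} {W : Set (Fin n → ℝ)}

lemma pd_congr (μ : Fin n) (hW : IsOpen W) (hx : x ∈ W) (h : ∀ y ∈ W, f y = g y) :
    pd μ f x = pd μ g x := by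
  unfold pd
  rw [Filter.EventuallyEq.fderiv_eq (Filter.eventually_of_mem (hW.mem_nhds hx) h)]

lemma pdC_congr {f g : (Fin n → ℝ) → ℂ} (μ : Fin n) (hW : IsOpen W) (hx : x ∈ W)
    (h : ∀ y ∈ W, f y = g y) : pdC μ f x = pdC μ g x := by
  unfold pdC
  rw [Filter.EventuallyEq.fderiv_eq (Filter.eventually_of_mem (hW.mem_nhds hx) h)]

lemma pd_mul (μ : Fin n) (hf : DifferentiableAt ℝ f x) (hg : DifferentiableAt ℝ g x) :
    pd μ (fun y => f y * g y) x = f x * pd μ g x + g x * pd μ f x := by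
  simp [pd, fderiv_fun_mul hf hg]

lemma pd_div_const (μ : Fin n) (c : ℝ) (hf : DifferentiableAt ℝ f x) :
    pd μ (fun y => f y / c) x = pd μ f x / c := by
  simp [pd, div_eq_inv_mul, fderiv_const_mul hf]

lemma differentiableAt_of_contDiffOn (hW : IsOpen W) (hx : x ∈ W)
    (hf : ContDiffOn ℝ (⊤ : ℕ∞) f W) : DifferentiableAt ℝ f x :=
  (hf.contDiffAt (hW.mem_nhds hx)).differentiableAt (by simp)

lemma contDiffOn_pd (μ : Fin n) (hW : IsOpen W) (hf : ContDiffOn ℝ (⊤ : ℕ∞) f W) :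
    ContDiffOn ℝ (⊤ : ℕ∞) (pd μ f) W :=
  (hf.fderiv_of_isOpen hW (by simp)).clm_apply contDiffOn_const

/-- Partial derivative of `(p + i q) e^{iS/c}` in terms of its real and imaginary amplitudes. -/
lemma pdC_amplitude_mul_phase (μ : Fin n) {p q S : (Fin n → ℝ) → ℝ} (c : ℝ)
    (hp : DifferentiableAt ℝ p x) (hq : DifferentiableAt ℝ q x) (hS : DifferentiableAt ℝ S x) :
    pdC μ (fun y => ((p y : ℂ) + Complex.I * (q y : ℂ)) *
        Complex.exp (Complex.I * (S y : ℂ) / (c : ℂ))) x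
      = (((pd μ p x - q x * pd μ S x / c : ℝ) : ℂ)
          + Complex.I * ((pd μ q x + p x * pd μ S x / c : ℝ) : ℂ)) *
        Complex.exp (Complex.I * (S x : ℂ) / (c : ℂ)) := by
  have ofReal {f : (Fin n → ℝ) → ℝ} (hf : DifferentiableAt ℝ f x) :
      HasFDerivAt (fun y => (f y : ℂ)) (Complex.ofRealCLM.comp (fderiv ℝ f x)) x :=
    Complex.ofRealCLM.hasFDerivAt.comp x hf.hasFDerivAt
  have hphase : HasFDerivAt (fun y => Complex.I * (S y : ℂ) / (c : ℂ))
      ((c : ℂ)⁻¹ • Complex.I • Complex.ofRealCLM.comp (fderiv ℝ S x)) x := by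
    simpa only [div_eq_mul_inv] using
      ((ofReal hS).const_mul Complex.I).mul_const ((c : ℂ)⁻¹)
  have h := ((ofReal hp).fun_add ((ofReal hq).const_mul Complex.I)).fun_mul hphase.cexp
  unfold pdC pd
  rw [h.fderiv]
  simp
  linear_combination ((q x : ℂ) * (fderiv ℝ S x (Pi.single μ 1) : ℂ) / c *
    Complex.exp (Complex.I * (S x : ℂ) / (c : ℂ))) * Complex.I_sq

end PartialDerivatives

/-- The Schrödinger operator on `a e^{iS/ħ}` at one point, split into real and imaginary parts
in terms of the derivatives of `a` and `S` at that point. -/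
lemma schrodinger_jet_iff {a V hbar m A0 S0 : ℝ} {A S AA SS : Fin 3 → ℝ} {e : ℂ} (he : e ≠ 0)
    (ha : 0 < a) (hhbar : 0 < hbar) (hm : 0 < m) :
    (Complex.I * (hbar : ℂ) * (((A0 : ℂ) + Complex.I * ((a * S0 / hbar : ℝ) : ℂ)) * e)
        = -((hbar : ℂ) ^ 2 / (2 * (m : ℂ))) *
            (∑ i, (((AA i - a * S i / hbar * S i / hbar : ℝ) : ℂ)
              + Complex.I * (((a * SS i + S i * A i) / hbar + A i * S i / hbar : ℝ) : ℂ)) * e)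
          + (V : ℂ) * ((a : ℂ) * e))
    ↔ (2 * a * A0 + ∑ i, (a ^ 2 * SS i + S i * (2 * a * A i)) / m = 0
      ∧ S0 + (∑ i, S i ^ 2) / (2 * m) + V
          - (hbar ^ 2 / (4 * m)) *
            ((∑ i, (2 * a * AA i + A i * (2 * A i))) / a ^ 2
              - (1/2) * (∑ i, (2 * a * A i) ^ 2) / (a ^ 2) ^ 2) = 0) := by
  have h1 : (2 * a * A0 + ∑ i, (a ^ 2 * SS i + S i * (2 * a * A i)) / m = 0) ↔
      hbar * A0 = -(hbar ^ 2 / (2 * m)) *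
        ∑ i, ((a * SS i + S i * A i) / hbar + A i * S i / hbar) := by
    simp only [Fin.sum_univ_three]
    rw [← sub_eq_zero (a := hbar * A0),
      ← mul_right_inj' (a := hbar / (2 * a)) (by positivity), mul_zero]
    refine Eq.congr ?_ rfl
    field_simp
    ring
  have h2 : (S0 + (∑ i, S i ^ 2) / (2 * m) + V
          - (hbar ^ 2 / (4 * m)) *
            ((∑ i, (2 * a * AA i + A i * (2 * A i))) / a ^ 2
              - (1/2) * (∑ i, (2 * a * A i) ^ 2) / (a ^ 2) ^ 2) = 0) ↔
      -(a * S0) = -(hbar ^ 2 / (2 * m)) * ∑ i, (AA i - a * S i / hbar * S i / hbar) + V * a := by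
    simp only [Fin.sum_univ_three]
    rw [← sub_eq_zero (a := -(a * S0)),
      ← mul_right_inj' (a := -a) (neg_ne_zero.mpr ha.ne'), mul_zero]
    refine Eq.congr ?_ rfl
    field_simp
    ring
  have key (P Q R T : ℝ) : ((P : ℂ) + Complex.I * Q = R + Complex.I * T) ↔ (Q = T ∧ P = R) := by
    simp [Complex.ext_iff, and_comm]
  rw [h1, h2, ← key]
  refine Iff.trans (Eq.congr ?_ ?_) (mul_left_inj' he)
  · have : (hbar : ℂ) ≠ 0 := by exact_mod_cast hhbar.ne'
    push_cast
    field_simp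
    linear_combination (a : ℂ) * S0 * Complex.I_sq
  · push_cast
    simp only [Fin.sum_univ_three]
    ring

/-- Madelung–Bohm form of the Schrödinger equation: with `ρ = a²` and
`ψ = a e^{iS/ħ}` on `W ⊆ ℝ × ℝ³` (coordinate `0` is time, coordinates `1,2,3` are space),
`ψ` satisfies `iħ ∂_t ψ = −(ħ²/(2m)) Δψ + V ψ` on `W` iff `(ρ, S)` satisfies the continuity
equation `∂_t ρ + div(ρ ∇S/m) = 0` and the Hamilton–Jacobi equation
`∂_t S + |∇S|²/(2m) + V − (ħ²/(4m))( Δρ/ρ − (1/2)|∇ρ|²/ρ² ) = 0` on `W`. -/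
theorem schrodinger_iff_madelung_bohm
    (W : Set (Fin 4 → ℝ)) (hW : IsOpen W) (hWne : W.Nonempty)
    (a S V : (Fin 4 → ℝ) → ℝ)
    (ha : ContDiffOn ℝ (⊤ : ℕ∞) a W) (hS : ContDiffOn ℝ (⊤ : ℕ∞) S W)
    (hV : ContDiffOn ℝ (⊤ : ℕ∞) V W)
    (hapos : ∀ x ∈ W, 0 < a x)
    (hbar m : ℝ) (hhbar : 0 < hbar) (hm : 0 < m)
    (ρ : (Fin 4 → ℝ) → ℝ) (hρ : ∀ y, ρ y = (a y) ^ 2)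
    (ψ : (Fin 4 → ℝ) → ℂ)
    (hψ : ∀ y, ψ y = (a y : ℂ) * Complex.exp (Complex.I * (S y : ℂ) / (hbar : ℂ))) :
    (∀ x ∈ W,
        Complex.I * (hbar : ℂ) * pdC (0 : Fin 4) ψ x
          = -((hbar : ℂ) ^ 2 / (2 * (m : ℂ))) * (∑ i : Fin 3, pdC i.succ (pdC i.succ ψ) x)
            + (V x : ℂ) * ψ x)
    ↔ ((∀ x ∈ W,
          pd (0 : Fin 4) ρ x
            + (∑ i : Fin 3, pd i.succ (fun y => ρ y * pd i.succ S y / m) x) = 0)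
      ∧ (∀ x ∈ W,
          pd (0 : Fin 4) S x + (∑ i : Fin 3, (pd i.succ S x) ^ 2) / (2 * m) + V x
            - (hbar ^ 2 / (4 * m)) *
                ((∑ i : Fin 3, pd i.succ (pd i.succ ρ) x) / ρ x
                  - (1/2) * (∑ i : Fin 3, (pd i.succ ρ x) ^ 2) / (ρ x) ^ 2) = 0)) := by
  have da {x} (hx : x ∈ W) := differentiableAt_of_contDiffOn hW hx ha
  have dS {x} (hx : x ∈ W) := differentiableAt_of_contDiffOn hW hx hS
  have dpa (μ : Fin 4) {x} (hx : x ∈ W) :=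
    differentiableAt_of_contDiffOn hW hx (contDiffOn_pd μ hW ha)
  have dpS (μ : Fin 4) {x} (hx : x ∈ W) :=
    differentiableAt_of_contDiffOn hW hx (contDiffOn_pd μ hW hS)
  obtain rfl : ρ = fun y => a y * a y := funext fun y => by rw [hρ, sq]
  have pd_density (μ : Fin 4) {x} (hx : x ∈ W) : pd μ (fun y => a y * a y) x = 2 * a x * pd μ a x := by
    rw [pd_mul μ (da hx) (da hx)]
    ring
  have pd_pd_density (μ : Fin 4) {x} (hx : x ∈ W) : pd μ (pd μ (fun y => a y * a y)) x
      = 2 * a x * pd μ (pd μ a) x + pd μ a x * (2 * pd μ a x) := by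
    have hdouble : pd μ (fun y => 2 * a y) x = 2 * pd μ a x := by
      simp [pd, fderiv_const_mul (da hx)]
    rw [pd_congr μ hW hx (fun y hy => pd_density μ hy), pd_mul μ ((da hx).const_mul 2) (dpa μ hx),
      hdouble]
  have pd_flux (μ : Fin 4) {x} (hx : x ∈ W) : pd μ (fun y => a y * a y * pd μ S y / m) x
      = (a x ^ 2 * pd μ (pd μ S) x + pd μ S x * (2 * a x * pd μ a x)) / m := by
    rw [pd_div_const μ m (((da hx).fun_mul (da hx)).fun_mul (dpS μ hx)),
      pd_mul μ ((da hx).fun_mul (da hx)) (dpS μ hx), pd_density μ hx, sq]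
  have pdC_wave (μ : Fin 4) {x} (hx : x ∈ W) : pdC μ ψ x
      = ((pd μ a x : ℂ) + Complex.I * ((a x * pd μ S x / hbar : ℝ) : ℂ)) *
        Complex.exp (Complex.I * (S x : ℂ) / (hbar : ℂ)) := by
    have h := pdC_amplitude_mul_phase μ hbar (da hx) (differentiableAt_const (0 : ℝ)) (dS hx)
    simpa [← hψ, pd] using h
  have pdC_pdC_wave (μ : Fin 4) {x} (hx : x ∈ W) : pdC μ (pdC μ ψ) x
      = (((pd μ (pd μ a) x - a x * pd μ S x / hbar * pd μ S x / hbar : ℝ) : ℂ)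
          + Complex.I * (((a x * pd μ (pd μ S) x + pd μ S x * pd μ a x) / hbar
              + pd μ a x * pd μ S x / hbar : ℝ) : ℂ)) *
        Complex.exp (Complex.I * (S x : ℂ) / (hbar : ℂ)) := by
    have hprod : DifferentiableAt ℝ (fun y => a y * pd μ S y) x := (da hx).fun_mul (dpS μ hx)
    have hquot : DifferentiableAt ℝ (fun y => a y * pd μ S y / hbar) x := by
      simpa only [div_eq_mul_inv] using hprod.mul_const hbar⁻¹
    rw [pdC_congr μ hW hx (fun y hy => pdC_wave μ hy),
      pdC_amplitude_mul_phase μ hbar (dpa μ hx) hquot (dS hx),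
      pd_div_const μ hbar hprod, pd_mul μ (da hx) (dpS μ hx)]
  rw [← forall₂_and]
  refine forall₂_congr fun x hx => ?_
  simp only [pdC_wave _ hx, pdC_pdC_wave _ hx, pd_density _ hx, pd_pd_density _ hx, pd_flux _ hx, hψ x]
  rw [← sq]
  exact schrodinger_jet_iff (Complex.exp_ne_zero _) (hapos x hx) hhbar hm
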